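/- (Intertwining lifting theorem for vector spaces, converse direction) Let K be a field and V₁, V₂ vector spaces over K, with linear maps T₁ : V₁ → V₁ and T₂ : V₂ → V₂. Let (W₁, I₁, U₁, P₁) and (W₂, I₂, U₂, P₂) be the standard dilations of T₁ and T₂, respectively. If R : W₂ → W₁ is a linear map such that U₁ ∘ R = R ∘ U₂ and R ∘ P₂ = P₁ ∘ R, then there exists a linear map S : V₂ → V₁ such that R ∘ I₂ = I₁ ∘ S and T₁ ∘ S = S ∘ T₂. -/

import Mathlib

/-- The unilateral shift moves a sequence supported at `0` to one supported at `1`. -/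
theorem shift_single_zero {V : Type*} [AddCommGroup V] {U : (ℕ →₀ V) → (ℕ →₀ V)}
    (hU0 : ∀ x : ℕ →₀ V, U x 0 = 0) (hUs : ∀ (x : ℕ →₀ V) (n : ℕ), U x (n + 1) = x n) (v : V) :
    U (Finsupp.single 0 v) = Finsupp.single 1 v := by
  ext n
  cases n with
  | zero => simp [hU0]
  | succ n => simp [hUs, Finsupp.single_apply, eq_comm]

/-- intertwining lifting, converse direction: given standard dilations
`(W₁, I₁, U₁, P₁)` and `(W₂, I₂, U₂, P₂)` of `T₁` and `T₂`, any linear `R : W₂ → W₁`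
with `U₁ ∘ R = R ∘ U₂` and `R ∘ P₂ = P₁ ∘ R` induces a linear `S : V₂ → V₁` with
`R ∘ I₂ = I₁ ∘ S` and `T₁ ∘ S = S ∘ T₂`. -/
theorem stmt_17 {K V₁ V₂ : Type*} [Field K]
    [AddCommGroup V₁] [Module K V₁] [AddCommGroup V₂] [Module K V₂]
    (T₁ : V₁ →ₗ[K] V₁) (T₂ : V₂ →ₗ[K] V₂)
    (I₁ : V₁ →ₗ[K] (ℕ →₀ V₁)) (hI₁ : ∀ x : V₁, I₁ x = Finsupp.single 0 x)
    (U₁ : (ℕ →₀ V₁) →ₗ[K] (ℕ →₀ V₁))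
    (hU₁0 : ∀ x : ℕ →₀ V₁, U₁ x 0 = 0)
    (hU₁s : ∀ (x : ℕ →₀ V₁) (n : ℕ), U₁ x (n + 1) = x n)
    (P₁ : (ℕ →₀ V₁) →ₗ[K] (ℕ →₀ V₁))
    (hP₁ : ∀ x : ℕ →₀ V₁, P₁ x = I₁ (x.sum fun n v => (T₁ ^ n) v))
    (I₂ : V₂ →ₗ[K] (ℕ →₀ V₂)) (hI₂ : ∀ x : V₂, I₂ x = Finsupp.single 0 x)
    (U₂ : (ℕ →₀ V₂) →ₗ[K] (ℕ →₀ V₂))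
    (hU₂0 : ∀ x : ℕ →₀ V₂, U₂ x 0 = 0)
    (hU₂s : ∀ (x : ℕ →₀ V₂) (n : ℕ), U₂ x (n + 1) = x n)
    (P₂ : (ℕ →₀ V₂) →ₗ[K] (ℕ →₀ V₂))
    (hP₂ : ∀ x : ℕ →₀ V₂, P₂ x = I₂ (x.sum fun n v => (T₂ ^ n) v))
    (R : (ℕ →₀ V₂) →ₗ[K] (ℕ →₀ V₁))
    (hRU : U₁ ∘ₗ R = R ∘ₗ U₂) (hRP : R ∘ₗ P₂ = P₁ ∘ₗ R) :
    ∃ S : V₂ →ₗ[K] V₁, R ∘ₗ I₂ = I₁ ∘ₗ S ∧ T₁ ∘ₗ S = S ∘ₗ T₂ := by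
  have hP₁_single (n : ℕ) (v : V₁) : P₁ (Finsupp.single n v) = Finsupp.single 0 ((T₁ ^ n) v) := by
    rw [hP₁, hI₁, Finsupp.sum_single_index (by simp)]
  have hP₂_single (n : ℕ) (v : V₂) : P₂ (Finsupp.single n v) = Finsupp.single 0 ((T₂ ^ n) v) := by
    rw [hP₂, hI₂, Finsupp.sum_single_index (by simp)]
  let S : V₂ →ₗ[K] V₁ := Finsupp.lapply 0 ∘ₗ R ∘ₗ I₂
  have hS (x : V₂) : R (Finsupp.single 0 x) = Finsupp.single 0 (S x) := by
    have h := LinearMap.congr_fun hRP (Finsupp.single 0 x)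
    simp only [LinearMap.comp_apply, hP₂_single, pow_zero, Module.End.one_apply, hP₁, hI₁] at h
    obtain ⟨v, hv⟩ : ∃ v, R (Finsupp.single 0 x) = Finsupp.single 0 v := ⟨_, h⟩
    simp [S, hI₂, hv]
  refine ⟨S, LinearMap.ext fun x => by simp [hI₁, hI₂, hS], LinearMap.ext fun x => ?_⟩
  apply Finsupp.single_injective 0
  calc Finsupp.single 0 (T₁ (S x))
      = P₁ (U₁ (R (Finsupp.single 0 x))) := by
        rw [hS, shift_single_zero hU₁0 hU₁s, hP₁_single, pow_one]
    _ = P₁ (R (U₂ (Finsupp.single 0 x))) :=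
        congrArg P₁ (LinearMap.congr_fun hRU _)
    _ = R (P₂ (U₂ (Finsupp.single 0 x))) := (LinearMap.congr_fun hRP _).symm
    _ = Finsupp.single 0 (S (T₂ x)) := by
        rw [shift_single_zero hU₂0 hU₂s, hP₂_single, pow_one, hS]
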